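/- arXiv:1209.5976 — 3 statements merged into one kernel-verified Lean document; each statement's English description precedes it below -/
import Mathlib

section
/- Let X be a nonnegative integrable real random variable on a probability space, K > 0 a real constant, and c₀ > 0 a real number such that P(c₀·X = K) = 0. Then the function g(c) = E[max(c·X − K, 0)] is differentiable at c₀ with g'(c₀) = E[ X·1_{c₀·X > K} ]. -/
open MeasureTheory

/-- GARCH delta hedge: for a nonnegative integrable `X`, `K > 0` and `c₀ > 0` with
`P(c₀·X = K) = 0`, the function `c ↦ E[max(c·X − K, 0)]` is differentiable at `c₀` with
derivative `E[X·1_{c₀·X > K}]`. -/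
theorem call_price_delta_hedge_derivative
    {Ω : Type*} [MeasurableSpace Ω] (μ : Measure Ω) [IsProbabilityMeasure μ]
    (X : Ω → ℝ) (hX_nonneg : ∀ ω, 0 ≤ X ω) (hX_int : Integrable X μ)
    (K : ℝ) (hK : 0 < K) (c₀ : ℝ) (hc₀ : 0 < c₀)
    (hnull : μ {ω | c₀ * X ω = K} = 0) :
    HasDerivAt (fun c => ∫ ω, max (c * X ω - K) 0 ∂μ)
      (∫ ω, (if K < c₀ * X ω then X ω else 0) ∂μ) c₀ := by
  have hpay (c : ℝ) : Integrable (fun ω => max (c * X ω - K) 0) μ :=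
    ((hX_int.const_mul c).sub (integrable_const K)).pos_part
  refine (hasDerivAt_integral_of_dominated_loc_of_lip (s := Set.univ) (bound := X)
    Filter.univ_mem (.of_forall fun c => (hpay c).aestronglyMeasurable) (hpay c₀) ?_
    (.of_forall fun ω => ?_) hX_int ?_).2
  · exact hX_int.aestronglyMeasurable.indicator₀
      (nullMeasurableSet_lt aemeasurable_const (hX_int.aemeasurable.const_mul c₀))
  · refine LipschitzOnWith.of_dist_le_mul fun a _ b _ => ?_
    rw [Real.dist_eq, Real.dist_eq, Real.coe_nnabs]
    calc |max (a * X ω - K) 0 - max (b * X ω - K) 0|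
        ≤ |a * X ω - K - (b * X ω - K)| := abs_max_sub_max_le_abs _ _ _
      _ = |X ω| * |a - b| := by rw [← abs_mul]; ring_nf
  · have hne : ∀ᵐ ω ∂μ, c₀ * X ω ≠ K := by simpa [ae_iff] using hnull
    filter_upwards [hne] with ω hω
    have hcont : ContinuousAt (fun c => c * X ω) c₀ := by fun_prop
    rcases hω.lt_or_gt with h | h
    · rw [if_neg h.not_gt]
      refine (hasDerivAt_const c₀ (0 : ℝ)).congr_of_eventuallyEq ?_
      filter_upwards [hcont.eventually_lt_const h] with c hc
      exact max_eq_right (by linarith)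
    · rw [if_pos h]
      refine ((hasDerivAt_mul_const (X ω)).sub_const K).congr_of_eventuallyEq ?_
      filter_upwards [hcont.eventually_const_lt h] with c hc
      exact max_eq_left (by linarith)
end

section
/- Let ε be a real random variable on a probability space with E[ε] = 0 and Var(ε) = 1, such that E[exp(z·ε)] < ∞ for all z in an open interval I containing σ, and let κ(z) = log E[exp(z·ε)] be its cumulant generating function. Let S, r, α₀, α₁, β₁, γ, λ be real constants, and set X = S·exp( r − κ(σ) + σ·ε ) and W = α₀ + α₁·σ²·(ε − γ − λ)² + (β₁ − 1)·σ². Then Cov(X, W) = α₁·e^r·S·σ²·( κ'(σ)² − 2(γ+λ)·κ'(σ) + κ''(σ) − 1 ). -/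
open MeasureTheory ProbabilityTheory

/-- Covariance between the one-step ahead asset price
`X = S·exp(r − κ(σ) + σ·ε)` and the next NGARCH conditional variance
`W = α₀ + α₁·σ²·(ε − γ − λ)² + (β₁ − 1)·σ²`:
`Cov(X, W) = α₁·e^r·S·σ²·(κ'(σ)² − 2(γ+λ)·κ'(σ) + κ''(σ) − 1)`. -/
theorem vega_multiplier_numerator
    {Ω : Type*} [MeasurableSpace Ω] (μ : Measure Ω) [IsProbabilityMeasure μ]
    (ε : Ω → ℝ) (hε : Measurable ε)
    (hmean : (∫ ω, ε ω ∂μ) = 0) (hvar : variance ε μ = 1)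
    (a b σ : ℝ) (hσ : σ ∈ Set.Ioo a b)
    (hint : ∀ z ∈ Set.Ioo a b, Integrable (fun ω => Real.exp (z * ε ω)) μ)
    (κ : ℝ → ℝ) (hκ : κ = fun z => Real.log (∫ ω, Real.exp (z * ε ω) ∂μ))
    (S r α₀ α₁ β₁ γ lam : ℝ) (X W : Ω → ℝ)
    (hX : X = fun ω => S * Real.exp (r - κ σ + σ * ε ω))
    (hW : W = fun ω => α₀ + α₁ * σ ^ 2 * (ε ω - γ - lam) ^ 2 + (β₁ - 1) * σ ^ 2) :
    (∫ ω, (X ω - ∫ ω', X ω' ∂μ) * (W ω - ∫ ω', W ω' ∂μ) ∂μ)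
      = α₁ * Real.exp r * S * σ ^ 2 *
          ((deriv κ σ) ^ 2 - 2 * (γ + lam) * deriv κ σ + deriv (deriv κ) σ - 1) := by
  have hσ_int : σ ∈ interior (integrableExpSet ε μ) :=
    mem_interior.2 ⟨Set.Ioo a b, fun z hz => hint z hz, isOpen_Ioo, hσ⟩
  have hκ_cgf : κ = cgf ε μ := hκ
  have hE : Integrable (fun ω => Real.exp (σ * ε ω)) μ := hint σ hσ
  have hM : 0 < mgf ε μ σ := mgf_pos hE
  have hE1 : Integrable (fun ω => ε ω * Real.exp (σ * ε ω)) μ := by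
    simpa using integrable_pow_mul_exp_of_mem_interior_integrableExpSet hσ_int 1
  have hE2 : Integrable (fun ω => ε ω ^ 2 * Real.exp (σ * ε ω)) μ :=
    integrable_pow_mul_exp_of_mem_interior_integrableExpSet hσ_int 2
  have hL2 : MemLp ε 2 μ :=
    memLp_two_of_variance_ne_zero hε.aestronglyMeasurable (hvar.trans_ne one_ne_zero)
  have hI1 : Integrable ε μ := hL2.integrable one_le_two
  have hI2 : Integrable (fun ω => ε ω ^ 2) μ := hL2.integrable_sq
  have hsq : ∫ ω, ε ω ^ 2 ∂μ = 1 := by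
    rw [← variance_of_integral_eq_zero hε.aemeasurable hmean, hvar]
  have hd1 : deriv κ σ = (∫ ω, ε ω * Real.exp (σ * ε ω) ∂μ) / mgf ε μ σ := by
    rw [hκ_cgf, deriv_cgf hσ_int]
  have hd2 : deriv (deriv κ) σ =
      (∫ ω, ε ω ^ 2 * Real.exp (σ * ε ω) ∂μ) / mgf ε μ σ - deriv κ σ ^ 2 := by
    have h := iteratedDeriv_two_cgf hσ_int
    rwa [iteratedDeriv_succ, iteratedDeriv_one, ← hκ_cgf] at h
  have hX' : X = fun ω => S * Real.exp r / mgf ε μ σ * Real.exp (σ * ε ω) := by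
    rw [hX, hκ_cgf]
    ext ω
    rw [Real.exp_add, Real.exp_sub, exp_cgf hE]
    ring
  have hXmean : ∫ ω, X ω ∂μ = S * Real.exp r := by
    simp only [hX', integral_const_mul]
    exact div_mul_cancel₀ _ hM.ne'
  have hquad : ∫ ω, (ε ω ^ 2 - 2 * (γ + lam) * ε ω) ∂μ = 1 := by
    rw [integral_sub hI2 (hI1.const_mul _), integral_const_mul, hsq, hmean]
    ring
  have hquad_int : Integrable (fun ω => ε ω ^ 2 - 2 * (γ + lam) * ε ω) μ :=
    hI2.sub (hI1.const_mul _)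
  have hW' : W = fun ω => α₁ * σ ^ 2 * (ε ω ^ 2 - 2 * (γ + lam) * ε ω)
      + (α₀ + α₁ * σ ^ 2 * (γ + lam) ^ 2 + (β₁ - 1) * σ ^ 2) := by
    rw [hW]
    ext ω
    ring
  have hWmean : ∫ ω, W ω ∂μ = α₁ * σ ^ 2
      + (α₀ + α₁ * σ ^ 2 * (γ + lam) ^ 2 + (β₁ - 1) * σ ^ 2) := by
    rw [hW', integral_add (hquad_int.const_mul _) (integrable_const _), integral_const_mul, hquad]
    simp
  have hprod : ∀ ω, (X ω - ∫ ω', X ω' ∂μ) * (W ω - ∫ ω', W ω' ∂μ) =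
      α₁ * σ ^ 2 * (S * Real.exp r) / mgf ε μ σ *
        (ε ω ^ 2 * Real.exp (σ * ε ω) - 2 * (γ + lam) * (ε ω * Real.exp (σ * ε ω))
          - Real.exp (σ * ε ω))
      - α₁ * σ ^ 2 * (S * Real.exp r) * (ε ω ^ 2 - 2 * (γ + lam) * ε ω - 1) := by
    intro ω
    rw [hXmean, hWmean, hX', hW']
    ring
  have hE12 : Integrable (fun ω => ε ω ^ 2 * Real.exp (σ * ε ω)
      - 2 * (γ + lam) * (ε ω * Real.exp (σ * ε ω))) μ :=
    hE2.sub (hE1.const_mul _)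
  have hE_int : Integrable (fun ω => ε ω ^ 2 * Real.exp (σ * ε ω)
      - 2 * (γ + lam) * (ε ω * Real.exp (σ * ε ω)) - Real.exp (σ * ε ω)) μ :=
    hE12.sub hE
  have hcentered_int : Integrable (fun ω => ε ω ^ 2 - 2 * (γ + lam) * ε ω - 1) μ :=
    hquad_int.sub (integrable_const 1)
  simp_rw [hprod]
  rw [integral_sub (hE_int.const_mul _) (hcentered_int.const_mul _),
    integral_const_mul, integral_const_mul, integral_sub hE12 hE,
    integral_sub hE2 (hE1.const_mul _), integral_const_mul,
    integral_sub hquad_int (integrable_const 1), hquad, hd2, hd1]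
  change _ / _ * (_ - _ - mgf ε μ σ) - _ = _
  simp only [integral_const, probReal_univ, smul_eq_mul]
  field_simp
  ring
end

section
/- Let ε be a real random variable on a probability space with E[ε] = 0 and Var(ε) = 1, such that E[exp(z·ε)] < ∞ for all z in an open interval containing σ and 2σ, with σ ≠ 0 and ε not almost surely constant, and let κ(z) = log E[exp(z·ε)] be its cumulant generating function. Let S ≠ 0, r, α₀, α₁, β₁, γ, λ be real constants, and set X = S·exp( r − κ(σ) + σ·ε ) and W = α₀ + α₁·σ²·(ε − γ − λ)² + (β₁ − 1)·σ². Then Var(X) ≠ 0 and Cov(X, W)/Var(X) = (α₁·σ² / (e^r·S)) · ( κ'(σ)² − 2(λ+γ)·κ'(σ) + κ''(σ) − 1 ) / ( e^{κ(2σ) − 2κ(σ)} − 1 ). -/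
open MeasureTheory ProbabilityTheory

/-- For a standardized `ε` and `Y = exp (σ ε)`, the covariance of an affine function of `Y` and a
quadratic function of `ε` in terms of the moments of `ε` against `Y`. -/
lemma integral_centered_mul_centered_quadratic
    {Ω : Type*} [MeasurableSpace Ω] {μ : Measure Ω} [IsProbabilityMeasure μ]
    {ε Y : Ω → ℝ} (hε : Integrable ε μ) (hε2 : Integrable (fun ω => ε ω ^ 2) μ)
    (hY : Integrable Y μ) (hεY : Integrable (fun ω => ε ω * Y ω) μ)
    (hε2Y : Integrable (fun ω => ε ω ^ 2 * Y ω) μ)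
    (hmean : (∫ ω, ε ω ∂μ) = 0) (hsq : (∫ ω, ε ω ^ 2 ∂μ) = 1) (c p q s : ℝ) :
    (∫ ω, (c * Y ω - ∫ ω', c * Y ω' ∂μ) *
        ((p + q * ε ω + s * ε ω ^ 2) - ∫ ω', (p + q * ε ω' + s * ε ω' ^ 2) ∂μ) ∂μ)
      = c * (s * (∫ ω, ε ω ^ 2 * Y ω ∂μ) + q * (∫ ω, ε ω * Y ω ∂μ) - s * ∫ ω, Y ω ∂μ) := by
  have h_quad : (∫ ω', (p + q * ε ω' + s * ε ω' ^ 2) ∂μ) = p + s := by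
    rw [integral_add ((integrable_const p).fun_add (hε.const_mul q)) (hε2.const_mul s),
      integral_add (integrable_const p) (hε.const_mul q), integral_const_mul, integral_const_mul,
      hmean, hsq]
    simp
  rw [h_quad, integral_const_mul]
  set m := ∫ ω, Y ω ∂μ with hm
  have h_expand : (fun ω => (c * Y ω - c * m) * ((p + q * ε ω + s * ε ω ^ 2) - (p + s)))
      = fun ω => c * s * (ε ω ^ 2 * Y ω) + c * q * (ε ω * Y ω) - c * s * Y ω
        - (c * m * q * ε ω + c * m * s * ε ω ^ 2 - c * m * s) := by
    funext ω
    ring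
  have h₁ := hε2Y.const_mul (c * s)
  have h₂ := hεY.const_mul (c * q)
  have h₃ := hY.const_mul (c * s)
  have h₄ := hε.const_mul (c * m * q)
  have h₅ := hε2.const_mul (c * m * s)
  have h₆ : Integrable (fun ω => c * s * (ε ω ^ 2 * Y ω) + c * q * (ε ω * Y ω) - c * s * Y ω) μ :=
    (h₁.add h₂).sub h₃
  have h₇ : Integrable (fun ω => c * m * q * ε ω + c * m * s * ε ω ^ 2 - c * m * s) μ :=
    (h₄.add h₅).sub (integrable_const _)
  rw [h_expand, integral_sub h₆ h₇,
    integral_sub (h₁.fun_add h₂) h₃, integral_add h₁ h₂,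
    integral_sub (h₄.fun_add h₅) (integrable_const (c * m * s)), integral_add h₄ h₅]
  simp only [integral_const_mul, hmean, hsq, integral_const, probReal_univ, ← hm, smul_eq_mul]
  ring

/-- The exponential of a nonzero multiple of a non-degenerate random variable has nonzero
variance. -/
lemma variance_exp_mul_ne_zero
    {Ω : Type*} [MeasurableSpace Ω] {μ : Measure Ω} {ε : Ω → ℝ} {σ : ℝ} (hσ : σ ≠ 0)
    (hne : ¬ ∃ c : ℝ, ε =ᵐ[μ] fun _ => c) [IsFiniteMeasure μ]
    (hY : MemLp (fun ω => Real.exp (σ * ε ω)) 2 μ) :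
    variance (fun ω => Real.exp (σ * ε ω)) μ ≠ 0 := by
  intro h
  have h_evar : evariance (fun ω => Real.exp (σ * ε ω)) μ = 0 := by
    rw [← hY.ofReal_variance_eq, h, ENNReal.ofReal_zero]
  rw [evariance_eq_zero_iff hY.aestronglyMeasurable.aemeasurable] at h_evar
  refine hne ⟨Real.log (∫ ω, Real.exp (σ * ε ω) ∂μ) / σ, ?_⟩
  filter_upwards [h_evar] with ω hω
  rw [← hω, Real.log_exp]
  field_simp

/-- Closed-form vega multiplier: with `X = S·exp(r − κ(σ) + σ·ε)` the one-step ahead asset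
price and `W` the next NGARCH conditional variance, `Var(X) ≠ 0` and
`Cov(X, W)/Var(X) = (α₁·σ²/(e^r·S))·(κ'(σ)² − 2(λ+γ)·κ'(σ) + κ''(σ) − 1)
  / (e^{κ(2σ) − 2κ(σ)} − 1)`. -/
theorem vega_multiplier_closed_form
    {Ω : Type*} [MeasurableSpace Ω] (μ : Measure Ω) [IsProbabilityMeasure μ]
    (ε : Ω → ℝ) (hε : Measurable ε)
    (hmean : (∫ ω, ε ω ∂μ) = 0) (hvar : variance ε μ = 1)
    (a b σ : ℝ) (hσ : σ ∈ Set.Ioo a b) (h2σ : 2 * σ ∈ Set.Ioo a b) (hσ0 : σ ≠ 0)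
    (hne : ¬ ∃ c : ℝ, ε =ᵐ[μ] fun _ => c)
    (hint : ∀ z ∈ Set.Ioo a b, Integrable (fun ω => Real.exp (z * ε ω)) μ)
    (κ : ℝ → ℝ) (hκ : κ = fun z => Real.log (∫ ω, Real.exp (z * ε ω) ∂μ))
    (S : ℝ) (hS : S ≠ 0) (r α₀ α₁ β₁ γ lam : ℝ) (X W : Ω → ℝ)
    (hX : X = fun ω => S * Real.exp (r - κ σ + σ * ε ω))
    (hW : W = fun ω => α₀ + α₁ * σ ^ 2 * (ε ω - γ - lam) ^ 2 + (β₁ - 1) * σ ^ 2) :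
    variance X μ ≠ 0 ∧
    (∫ ω, (X ω - ∫ ω', X ω' ∂μ) * (W ω - ∫ ω', W ω' ∂μ) ∂μ) / variance X μ
      = (α₁ * σ ^ 2 / (Real.exp r * S)) *
          (((deriv κ σ) ^ 2 - 2 * (lam + γ) * deriv κ σ + deriv (deriv κ) σ - 1)
            / (Real.exp (κ (2 * σ) - 2 * κ σ) - 1)) := by
  have hσ_int : σ ∈ interior (integrableExpSet ε μ) :=
    interior_maximal (fun z hz => hint z hz) isOpen_Ioo hσ
  have hκ_cgf : κ = cgf ε μ := hκ
  have hε_L2 : MemLp ε 2 μ := by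
    by_contra h
    rw [variance_of_not_memLp hε.aestronglyMeasurable h] at hvar
    exact zero_ne_one hvar
  have hsq : (∫ ω, ε ω ^ 2 ∂μ) = 1 := by
    rw [variance_of_integral_eq_zero hε.aemeasurable hmean] at hvar
    exact hvar
  have h_sq_exp : ∀ ω, Real.exp (σ * ε ω) ^ 2 = Real.exp (2 * σ * ε ω) := fun ω => by
    rw [← Real.exp_nat_mul]
    congr 1
    push_cast
    ring
  have hY := hint σ hσ
  have hY_L2 : MemLp (fun ω => Real.exp (σ * ε ω)) 2 μ := by
    rw [memLp_two_iff_integrable_sq hY.aestronglyMeasurable]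
    simpa only [h_sq_exp] using hint _ h2σ
  have hεY : Integrable (fun ω => ε ω * Real.exp (σ * ε ω)) μ := by
    simpa using integrable_pow_mul_exp_of_mem_interior_integrableExpSet hσ_int 1
  have hε2Y := integrable_pow_mul_exp_of_mem_interior_integrableExpSet hσ_int 2
  have hvarY := variance_exp_mul_ne_zero hσ0 hne hY_L2
  have hm_pos : 0 < mgf ε μ σ := mgf_pos hY
  have hvarY_eq : variance (fun ω => Real.exp (σ * ε ω)) μ
      = mgf ε μ (2 * σ) - mgf ε μ σ ^ 2 := by
    rw [variance_eq_sub hY_L2]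
    simp only [Pi.pow_apply, h_sq_exp, mgf]
  have hκ_exp : Real.exp (κ (2 * σ) - 2 * κ σ) = mgf ε μ (2 * σ) / mgf ε μ σ ^ 2 := by
    rw [hκ_cgf, Real.exp_sub, two_mul (cgf ε μ σ), Real.exp_add, exp_cgf (hint _ h2σ), exp_cgf hY,
      sq]
  have hX' : X = fun ω => (S * (Real.exp r / mgf ε μ σ)) * Real.exp (σ * ε ω) := by
    rw [hX]
    funext ω
    rw [Real.exp_add, Real.exp_sub, hκ_cgf, exp_cgf hY]
    ring
  have hW' : W = fun ω => (α₀ + α₁ * σ ^ 2 * (γ + lam) ^ 2 + (β₁ - 1) * σ ^ 2)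
      + (-(2 * α₁ * σ ^ 2 * (γ + lam))) * ε ω + (α₁ * σ ^ 2) * ε ω ^ 2 := by
    rw [hW]
    funext ω
    ring
  have hderiv : (∫ ω, ε ω * Real.exp (σ * ε ω) ∂μ) = deriv κ σ * mgf ε μ σ := by
    rw [hκ_cgf, deriv_cgf hσ_int, div_mul_cancel₀ _ hm_pos.ne']
  have hderiv2 : (∫ ω, ε ω ^ 2 * Real.exp (σ * ε ω) ∂μ)
      = (deriv (deriv κ) σ + deriv κ σ ^ 2) * mgf ε μ σ := by
    have h := iteratedDeriv_two_cgf hσ_int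
    rw [iteratedDeriv_succ, iteratedDeriv_one] at h
    rw [hκ_cgf, h, sub_add_cancel, div_mul_cancel₀ _ hm_pos.ne']
  have hmgf : (∫ ω, Real.exp (σ * ε ω) ∂μ) = mgf ε μ σ := rfl
  have hvarX : variance X μ = (S * (Real.exp r / mgf ε μ σ)) ^ 2
      * (mgf ε μ (2 * σ) - mgf ε μ σ ^ 2) := by
    rw [hX', variance_const_mul, hvarY_eq]
  rw [hvarY_eq] at hvarY
  have hm := hm_pos.ne'
  refine ⟨?_, ?_⟩
  · rw [hvarX]
    positivity
  · rw [hvarX, hκ_exp, hX', hW',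
      integral_centered_mul_centered_quadratic (hε_L2.integrable one_le_two) hε_L2.integrable_sq
        hY hεY hε2Y hmean hsq, hderiv, hderiv2, hmgf, div_sub_one (pow_ne_zero 2 hm)]
    field_simp
    ring
end
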